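/- N(Γ(4)) = 10: the set of cosets P·SL₂(ℤ) in SL₂(ℝ)/SL₂(ℤ) such that P⁻¹·A·P has integer entries for every A ∈ Γ(4) has exactly 10 elements. -/

import Mathlib

open Matrix MatrixGroups CongruenceSubgroup

/-- A real 2×2 matrix has integer entries. -/
def IsIntegerMatrix (M : Matrix (Fin 2) (Fin 2) ℝ) : Prop :=
  ∀ i j, ∃ k : ℤ, M i j = (k : ℝ)

/-- The embedding `SL(2, ℤ) →* SL(2, ℝ)`. -/
noncomputable def toSL2R : SL(2, ℤ) →* SL(2, ℝ) :=
  Matrix.SpecialLinearGroup.map (Int.castRingHom ℝ)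

/-- `SL(2, ℤ)` as a subgroup of `SL(2, ℝ)`. -/
noncomputable def SL2ZinR : Subgroup SL(2, ℝ) := toSL2R.range

/-- The set of cosets `P·SL₂(ℤ)` in `SL₂(ℝ)/SL₂(ℤ)` such that `P⁻¹·A·P` has integer
entries for every `A ∈ G`; its cardinality is `N(G)`. -/
noncomputable def goodCosets (G : Subgroup SL(2, ℤ)) : Set (SL(2, ℝ) ⧸ SL2ZinR) :=
  {x | ∃ P : SL(2, ℝ), x = QuotientGroup.mk P ∧ ∀ A ∈ G,
    IsIntegerMatrix ((P⁻¹ * toSL2R A * P : SL(2, ℝ)) : Matrix (Fin 2) (Fin 2) ℝ)}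

lemma coe_toSL2R_apply (A : SL(2, ℤ)) (i j : Fin 2) : toSL2R A i j = (A i j : ℝ) :=
  rfl

lemma isIntegerMatrix_iff_mem_SL2ZinR (g : SL(2, ℝ)) :
    IsIntegerMatrix (g : Matrix (Fin 2) (Fin 2) ℝ) ↔ g ∈ SL2ZinR := by
  constructor
  · intro h
    choose f hf using h
    have hdet : (Matrix.of f).det = 1 := by
      have h1 := g.det_coe
      rw [Matrix.det_fin_two] at h1 ⊢
      simp only [hf] at h1
      exact_mod_cast h1
    refine ⟨⟨Matrix.of f, hdet⟩, ?_⟩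
    ext i j
    rw [hf]
    rfl
  · rintro ⟨A, rfl⟩ i j
    exact ⟨A i j, by simp [coe_toSL2R_apply]⟩

/-- `P⁻¹ * A * P` is integral for every `A` in `G`. -/
def ConjIntegral (G : Subgroup SL(2, ℤ)) (P : SL(2, ℝ)) : Prop :=
  ∀ A ∈ G, IsIntegerMatrix ((P⁻¹ * toSL2R A * P : SL(2, ℝ)) : Matrix (Fin 2) (Fin 2) ℝ)

lemma ConjIntegral.of_mk_eq {G : Subgroup SL(2, ℤ)} {P Q : SL(2, ℝ)} (h : ConjIntegral G P)
    (hPQ : (QuotientGroup.mk P : SL(2, ℝ) ⧸ SL2ZinR) = QuotientGroup.mk Q) :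
    ConjIntegral G Q := by
  intro A hA
  rw [QuotientGroup.eq] at hPQ
  have h1 := (isIntegerMatrix_iff_mem_SL2ZinR _).1 (h A hA)
  rw [isIntegerMatrix_iff_mem_SL2ZinR]
  have h2 := mul_mem (mul_mem (inv_mem hPQ) h1) hPQ
  convert h2 using 1
  group

lemma mem_goodCosets_mk {G : Subgroup SL(2, ℤ)} {P : SL(2, ℝ)} :
    (QuotientGroup.mk P : SL(2, ℝ) ⧸ SL2ZinR) ∈ goodCosets G ↔ ConjIntegral G P :=
  ⟨fun ⟨_, hQ, h⟩ => ConjIntegral.of_mk_eq h hQ.symm, fun h => ⟨P, rfl, h⟩⟩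

/-- The upper triangular matrix with rows `(t⁻¹, q)` and `(0, t)`. -/
noncomputable def upperSL (t q : ℝ) (ht : t ≠ 0) : SL(2, ℝ) :=
  ⟨!![t⁻¹, q; 0, t], by simp [Matrix.det_fin_two, ht]⟩

lemma coe_inv_mul_mul (P B : SL(2, ℝ)) :
    ((P⁻¹ * B * P : SL(2, ℝ)) : Matrix (Fin 2) (Fin 2) ℝ) =
      !![P 1 1, -P 0 1; -P 1 0, P 0 0] * !![B 0 0, B 0 1; B 1 0, B 1 1] *
        !![P 0 0, P 0 1; P 1 0, P 1 1] := by
  rw [← Matrix.eta_fin_two (B : Matrix (Fin 2) (Fin 2) ℝ),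
    ← Matrix.eta_fin_two (P : Matrix (Fin 2) (Fin 2) ℝ)]
  simp [Matrix.SpecialLinearGroup.coe_inv, Matrix.adjugate_fin_two]

lemma ConjIntegral.isIntegerMatrix_mul {P : SL(2, ℝ)} (h : ConjIntegral (Gamma 4) P)
    (a b c d : ℤ) (hdet : a * d - b * c = 1) (ha : (a : ZMod 4) = 1) (hb : (b : ZMod 4) = 0)
    (hc : (c : ZMod 4) = 0) (hd : (d : ZMod 4) = 1) :
    IsIntegerMatrix (!![P 1 1, -P 0 1; -P 1 0, P 0 0] * !![(a : ℝ), b; c, d] *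
      !![P 0 0, P 0 1; P 1 0, P 1 1]) := by
  have hA := h ⟨!![a, b; c, d], by rw [Matrix.det_fin_two]; exact hdet⟩
    (Gamma_mem.2 ⟨ha, hb, hc, hd⟩)
  rw [coe_inv_mul_mul] at hA
  exact hA

lemma coe_upperSL_inv_mul (t q t' q' : ℝ) (ht : t ≠ 0) (ht' : t' ≠ 0) :
    (((upperSL t q ht)⁻¹ * upperSL t' q' ht' : SL(2, ℝ)) : Matrix (Fin 2) (Fin 2) ℝ) =
      !![t * t'⁻¹, t * q' - q * t'; 0, t⁻¹ * t'] := by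
  rw [Matrix.SpecialLinearGroup.coe_mul, Matrix.SpecialLinearGroup.coe_inv]
  simp [Matrix.adjugate_fin_two, upperSL]
  ring

lemma mk_upperSL_eq_iff (t q t' q' : ℝ) (ht : 0 < t) (ht' : 0 < t') :
    (QuotientGroup.mk (upperSL t q ht.ne') : SL(2, ℝ) ⧸ SL2ZinR) =
        QuotientGroup.mk (upperSL t' q' ht'.ne') ↔
      t = t' ∧ ∃ m : ℤ, t * q' - t * q = m := by
  rw [QuotientGroup.eq, ← isIntegerMatrix_iff_mem_SL2ZinR, coe_upperSL_inv_mul]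
  constructor
  · intro h
    obtain ⟨a, ha⟩ := h 0 0
    obtain ⟨b, hb⟩ := h 0 1
    obtain ⟨d, hd⟩ := h 1 1
    simp only [of_apply, cons_val', cons_val_zero, cons_val_one, cons_val_fin_one] at ha hb hd
    have had : a * d = 1 := by
      have : (a : ℝ) * d = 1 := by rw [← ha, ← hd]; field_simp
      exact_mod_cast this
    have ha0 : 0 < a := by
      have : (0 : ℝ) < a := by rw [← ha]; positivity
      exact_mod_cast this
    have ha1 : a = 1 := Int.eq_one_of_mul_eq_one_right ha0.le had
    have htt : t = t' := by
      rw [ha1] at ha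
      field_simp at ha
      simpa using ha
    refine ⟨htt, b, ?_⟩
    rw [← hb, ← htt]
    ring
  · rintro ⟨rfl, m, hm⟩ i j
    fin_cases i <;> fin_cases j
    · exact ⟨1, by simp [ht.ne']⟩
    · exact ⟨m, by simp [← hm, mul_comm]⟩
    · exact ⟨0, by simp⟩
    · exact ⟨1, by simp [ht.ne']⟩

lemma conjIntegral_Gamma_four_upperSL_iff (t q : ℝ) (ht : t ≠ 0) :
    ConjIntegral (Gamma 4) (upperSL t q ht) ↔
      (∃ m : ℤ, 4 * t ^ 2 = m) ∧ (∃ m : ℤ, 4 * t⁻¹ ^ 2 = m) ∧ (∃ m : ℤ, 4 * (t⁻¹ * q) = m) ∧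
        (∃ m : ℤ, 4 * q ^ 2 = m) ∧ ∃ m : ℤ, 8 * (t * q) = m := by
  constructor
  · intro h
    have h1 := h.isIntegerMatrix_mul 1 4 0 1 (by norm_num) (by decide) (by decide)
      (by decide) (by decide)
    have h2 := h.isIntegerMatrix_mul 1 0 4 1 (by norm_num) (by decide) (by decide)
      (by decide) (by decide)
    have h3 := h.isIntegerMatrix_mul 5 4 16 13 (by norm_num) (by decide) (by decide)
      (by decide) (by decide)
    obtain ⟨a, ha⟩ := h1 0 1
    obtain ⟨b, hb⟩ := h2 1 0
    obtain ⟨c, hc⟩ := h2 1 1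
    obtain ⟨d, hd⟩ := h2 0 1
    obtain ⟨f, hf⟩ := h3 0 1
    simp [upperSL, Matrix.mul_apply, Fin.sum_univ_two] at ha hb hc hd hf
    have htt : t⁻¹ * t = 1 := inv_mul_cancel₀ ht
    refine ⟨⟨a, by linear_combination ha⟩, ⟨b, by linear_combination hb⟩,
      ⟨c - 1, by push_cast; linear_combination hc - htt⟩, ⟨-d, by push_cast; linear_combination -hd⟩,
      ⟨a + 4 * d - f, by push_cast; linear_combination ha + 4 * hd - hf⟩⟩
  · rintro ⟨⟨n₁, h₁⟩, ⟨n₂, h₂⟩, ⟨n₃, h₃⟩, ⟨n₄, h₄⟩, ⟨n₅, h₅⟩⟩ A hA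
    have htt : t⁻¹ * t = 1 := inv_mul_cancel₀ ht
    have hdet := A.det_coe
    rw [Matrix.det_fin_two] at hdet
    rw [Gamma_mem] at hA
    obtain ⟨ha, hb, hc, hd⟩ := hA
    have key : ∀ x y : ℤ, (x : ZMod 4) = (y : ZMod 4) → ∃ z, x = y + 4 * z := by
      intro x y hxy
      obtain ⟨z, hz⟩ := (ZMod.intCast_eq_intCast_iff_dvd_sub y x 4).1 hxy.symm
      exact ⟨z, by push_cast at hz; linarith⟩
    obtain ⟨a, ha⟩ := key _ 1 (by simpa using ha)
    obtain ⟨b, hb⟩ := key _ 0 (by simpa using hb)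
    obtain ⟨c, hc⟩ := key _ 0 (by simpa using hc)
    obtain ⟨d, hd⟩ := key _ 1 (by simpa using hd)
    rw [ha, hb, hc, hd] at hdet
    have hdet' : a + d + 4 * (a * d) - 4 * (b * c) = 0 := by linarith
    have hdetR : (a : ℝ) + d + 4 * (a * d) - 4 * (b * c) = 0 := by exact_mod_cast hdet'
    rw [coe_inv_mul_mul]
    intro i j
    fin_cases i <;> fin_cases j
    · refine ⟨1 + 4 * a - c * n₃, ?_⟩
      simp [coe_toSL2R_apply, upperSL, Matrix.mul_apply, Fin.sum_univ_two, ha, hb, hc, hd]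
      linear_combination (1 + 4 * a : ℝ) * htt - c * h₃
    · refine ⟨b * n₁ - c * n₄ + n₅ * (2 * (b * c) - 2 * (a * d) - d), ?_⟩
      simp [coe_toSL2R_apply, upperSL, Matrix.mul_apply, Fin.sum_univ_two, ha, hb, hc, hd]
      linear_combination b * h₁ - c * h₄ + (2 * (b * c) - 2 * (a * d) - d : ℝ) * h₅ +
        4 * t * q * hdetR
    · refine ⟨c * n₂, ?_⟩
      simp [coe_toSL2R_apply, upperSL, Matrix.mul_apply, Fin.sum_univ_two, ha, hb, hc, hd]
      linear_combination c * h₂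
    · refine ⟨1 + 4 * d + c * n₃, ?_⟩
      simp [coe_toSL2R_apply, upperSL, Matrix.mul_apply, Fin.sum_univ_two, ha, hb, hc, hd]
      linear_combination (1 + 4 * d : ℝ) * htt + c * h₃

lemma exists_mk_eq_upperSL (P : SL(2, ℝ)) (h : ConjIntegral (Gamma 4) P) :
    ∃ (t q : ℝ) (ht : 0 < t),
      (QuotientGroup.mk P : SL(2, ℝ) ⧸ SL2ZinR) = QuotientGroup.mk (upperSL t q ht.ne') := by
  have hγ : ∃ γ : SL(2, ℤ), P 1 0 * γ 0 0 + P 1 1 * γ 1 0 = 0 := by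
    by_cases hr : P 1 0 = 0
    · exact ⟨1, by simp [hr]⟩
    have h1 := h.isIntegerMatrix_mul 1 4 0 1 (by norm_num) (by decide) (by decide)
      (by decide) (by decide)
    obtain ⟨m, hm⟩ := h1 1 0
    obtain ⟨k, hk⟩ := h1 1 1
    simp [Matrix.mul_apply, Fin.sum_univ_two] at hm hk
    have hdet := P.det_coe
    rw [Matrix.det_fin_two] at hdet
    have hm' : -4 * P 1 0 ^ 2 = (m : ℝ) := by linear_combination hm
    have hk' : -4 * (P 1 0 * P 1 1) = ((k - 1 : ℤ) : ℝ) := by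
      push_cast; linear_combination hk - hdet
    have hm0 : m ≠ 0 := by
      rintro rfl
      simp [hr] at hm'
    have hg : 0 < Int.gcd (k - 1) m := Int.gcd_pos_of_ne_zero_right _ hm0
    obtain ⟨g, x, y, -, hxy, hx, hy⟩ := Int.exists_gcd_one' hg
    obtain ⟨γ, h0, h1⟩ := (show IsCoprime x (-y) from
      (Int.isCoprime_iff_gcd_eq_one.2 hxy).neg_right).exists_SL2_col 0
    refine ⟨γ, ?_⟩
    rw [h0, h1]
    have hg0 : (g : ℝ) ≠ 0 := by
      intro h0
      have : g = 0 := by exact_mod_cast h0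
      exact hm0 (by rw [hy, this]; simp)
    rw [hx] at hk'
    rw [hy] at hm'
    push_cast at hk' hm' ⊢
    refine mul_left_cancel₀ hg0 ?_
    linear_combination -P 1 0 * hk' + P 1 1 * hm'
  obtain ⟨γ, hγ⟩ := hγ
  obtain ⟨Q, hQ, hQ0⟩ : ∃ Q : SL(2, ℝ),
      (QuotientGroup.mk P : SL(2, ℝ) ⧸ SL2ZinR) = QuotientGroup.mk Q ∧ Q 1 0 = 0 := by
    refine ⟨P * toSL2R γ, ?_, ?_⟩
    · rw [QuotientGroup.eq]
      exact ⟨γ, by group⟩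
    · simpa [coe_toSL2R_apply, Matrix.mul_apply, Fin.sum_univ_two] using hγ
  have hdet := Q.det_coe
  rw [Matrix.det_fin_two, hQ0, mul_zero, sub_zero] at hdet
  have hne : Q 1 1 ≠ 0 := right_ne_zero_of_mul_eq_one hdet
  have hinv : Q 0 0 = (Q 1 1)⁻¹ := eq_inv_of_mul_eq_one_left hdet
  rcases hne.lt_or_gt with hneg | hpos
  · refine ⟨-Q 1 1, -Q 0 1, by linarith, hQ.trans ?_⟩
    rw [QuotientGroup.eq]
    refine ⟨-1, ?_⟩
    rw [eq_inv_mul_iff_mul_eq]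
    ext i j
    fin_cases i <;> fin_cases j <;>
      simp [coe_toSL2R_apply, upperSL, hQ0, hinv, Matrix.mul_apply, Fin.sum_univ_two, inv_neg]
  · refine ⟨Q 1 1, Q 0 1, hpos, hQ.trans (congrArg _ ?_)⟩
    ext i j
    fin_cases i <;> fin_cases j <;> simp [upperSL, hQ0, hinv]

lemma sqrt_two_pow_half_pos (e : ℕ) : 0 < √(2 ^ e) / 2 := by positivity

/-- The representative with `4 t ^ 2 = 2 ^ e` and `8 t q = k`. -/
noncomputable def cosetRep (p : ℕ × ℕ) : SL(2, ℝ) :=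
  upperSL (√(2 ^ p.1) / 2) (p.2 / (8 * (√(2 ^ p.1) / 2))) (sqrt_two_pow_half_pos p.1).ne'

lemma conjIntegral_cosetRep_iff (e k : ℕ) :
    ConjIntegral (Gamma 4) (cosetRep (e, k)) ↔ e < 5 ∧ 2 ^ e ∣ 2 * k ∧ 4 * 2 ^ e ∣ k ^ 2 := by
  have div_iff : ∀ a b : ℕ, b ≠ 0 → ((∃ m : ℤ, (a : ℝ) / b = m) ↔ b ∣ a) := by
    intro a b hb
    have hb' : (b : ℝ) ≠ 0 := by exact_mod_cast hb
    rw [← Int.natCast_dvd_natCast]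
    refine exists_congr fun m => ?_
    rw [div_eq_iff hb', mul_comm]
    exact_mod_cast Iff.rfl
  have hs : √(2 ^ e : ℝ) ^ 2 = 2 ^ e := Real.sq_sqrt (by positivity)
  have hpos : (0 : ℝ) < √(2 ^ e) := by positivity
  have e1 : 4 * (√(2 ^ e : ℝ) / 2) ^ 2 = ((2 ^ e : ℤ) : ℝ) := by
    push_cast; linear_combination hs
  have e2 : 4 * (√(2 ^ e : ℝ) / 2)⁻¹ ^ 2 = ((16 : ℕ) : ℝ) / ((2 ^ e : ℕ) : ℝ) := by
    push_cast; field_simp; rw [hs]; ring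
  have e3 : 4 * ((√(2 ^ e : ℝ) / 2)⁻¹ * (k / (8 * (√(2 ^ e) / 2)))) =
      ((2 * k : ℕ) : ℝ) / ((2 ^ e : ℕ) : ℝ) := by
    push_cast; field_simp; rw [hs]; ring
  have e4 : 4 * (k / (8 * (√(2 ^ e : ℝ) / 2))) ^ 2 =
      ((k ^ 2 : ℕ) : ℝ) / ((4 * 2 ^ e : ℕ) : ℝ) := by
    push_cast; field_simp; rw [hs]; ring
  have e5 : 8 * (√(2 ^ e : ℝ) / 2 * (k / (8 * (√(2 ^ e) / 2)))) = ((k : ℤ) : ℝ) := by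
    push_cast; field_simp
  have h16 : 2 ^ e ∣ 16 ↔ e < 5 := by
    rw [show 16 = 2 ^ 4 by norm_num, Nat.pow_dvd_pow_iff_le_right (by norm_num)]
    omega
  rw [cosetRep, conjIntegral_Gamma_four_upperSL_iff]
  simp only
  rw [e1, e2, e3, e4, e5, div_iff _ _ (by positivity), div_iff _ _ (by positivity),
    div_iff _ _ (by positivity), h16]
  exact ⟨fun ⟨_, h1, h2, h3, _⟩ => ⟨h1, h2, h3⟩,
    fun ⟨h1, h2, h3⟩ => ⟨⟨_, rfl⟩, h1, h2, h3, ⟨_, rfl⟩⟩⟩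

lemma exists_mk_eq_cosetRep (P : SL(2, ℝ)) (h : ConjIntegral (Gamma 4) P) :
    ∃ e k : ℕ, k < 8 ∧
      (QuotientGroup.mk P : SL(2, ℝ) ⧸ SL2ZinR) = QuotientGroup.mk (cosetRep (e, k)) := by
  obtain ⟨t, q, ht, hP⟩ := exists_mk_eq_upperSL P h
  obtain ⟨⟨m, hm⟩, ⟨n, hn⟩, -, -, ⟨l, hl⟩⟩ :=
    (conjIntegral_Gamma_four_upperSL_iff t q ht.ne').1 (h.of_mk_eq hP)
  have hmn : m * n = 16 := by
    have : (m : ℝ) * n = 16 := by rw [← hm, ← hn]; field_simp; norm_num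
    exact_mod_cast this
  have hm0 : 0 < m := by
    have : (0 : ℝ) < m := by rw [← hm]; positivity
    exact_mod_cast this
  lift m to ℕ using hm0.le
  obtain ⟨e, -, rfl⟩ := (Nat.dvd_prime_pow Nat.prime_two (m := 4)).1
    (Int.natCast_dvd_natCast.1 ⟨n, by push_cast; linarith⟩ : m ∣ 2 ^ 4)
  have hte : t = √(2 ^ e) / 2 := by
    rw [eq_div_iff two_ne_zero]
    refine (Real.sqrt_eq_iff_mul_self_eq (by positivity) (by positivity)).2 ?_ |>.symm
    push_cast at hm
    linear_combination -hm
  have hk : ((l % 8).toNat : ℤ) = l % 8 := Int.toNat_of_nonneg (Int.emod_nonneg _ (by norm_num))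
  refine ⟨e, (l % 8).toNat, by omega, hP.trans ?_⟩
  rw [cosetRep, mk_upperSL_eq_iff _ _ _ _ ht (sqrt_two_pow_half_pos e)]
  refine ⟨hte, -(l / 8), ?_⟩
  have hl8 : (((l % 8).toNat : ℕ) : ℝ) + 8 * ((l / 8 : ℤ) : ℝ) = (l : ℝ) := by
    have : ((l % 8).toNat : ℤ) + 8 * (l / 8) = l := by omega
    exact_mod_cast this
  simp only [← hte]
  push_cast
  field_simp
  linear_combination hl8 - hl

lemma mk_cosetRep_injOn :
    Set.InjOn (fun p => (QuotientGroup.mk (cosetRep p) : SL(2, ℝ) ⧸ SL2ZinR))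
      {p | p.2 < 8} := by
  rintro ⟨e, k⟩ hk ⟨e', k'⟩ hk' h
  simp only [Set.mem_ofPred_eq] at hk hk'
  simp only [cosetRep] at h
  rw [mk_upperSL_eq_iff _ _ _ _ (sqrt_two_pow_half_pos e) (sqrt_two_pow_half_pos e')] at h
  obtain ⟨ht, m, hm⟩ := h
  have hee : e = e' := by
    have h1 : √(2 ^ e : ℝ) = √(2 ^ e') := by linarith
    rw [Real.sqrt_inj (by positivity) (by positivity)] at h1
    exact pow_right_injective₀ (by norm_num) (by norm_num) h1
  subst hee
  have hpos : (0 : ℝ) < √(2 ^ e) := by positivity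
  field_simp at hm
  have hm' : (k' : ℤ) - k = 8 * m := by
    have : (k' : ℝ) - k = 8 * m := by linarith
    exact_mod_cast this
  have : k = k' := by omega
  rw [this]

/-- The parameters of the representatives of the cosets counted by `N(Γ(4))`. -/
def cosetParams : Finset (ℕ × ℕ) :=
  (Finset.range 5 ×ˢ Finset.range 8).filter
    fun p => 2 ^ p.1 ∣ 2 * p.2 ∧ 4 * 2 ^ p.1 ∣ p.2 ^ 2

lemma goodCosets_Gamma_four_eq_image :
    goodCosets (Gamma 4) =
      (fun p => QuotientGroup.mk (cosetRep p)) '' (cosetParams : Set (ℕ × ℕ)) := by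
  ext x
  constructor
  · rintro ⟨P, rfl, h⟩
    obtain ⟨e, k, hk, hP⟩ := exists_mk_eq_cosetRep P h
    obtain ⟨he, h1, h2⟩ := (conjIntegral_cosetRep_iff e k).1 (ConjIntegral.of_mk_eq h hP)
    exact ⟨(e, k), by simp [cosetParams, he, hk, h1, h2], hP.symm⟩
  · rintro ⟨⟨e, k⟩, hp, rfl⟩
    simp only [cosetParams, Finset.coe_filter, Finset.mem_product, Finset.mem_range,
      Set.mem_ofPred_eq] at hp
    exact mem_goodCosets_mk.2 ((conjIntegral_cosetRep_iff e k).2 ⟨hp.1.1, hp.2⟩)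

/-- `N(Γ(4)) = 10`. -/
theorem stmt_19 : (goodCosets (Gamma 4)).ncard = 10 := by
  rw [goodCosets_Gamma_four_eq_image, Set.InjOn.ncard_image, Set.ncard_coe_finset]
  · decide
  · refine mk_cosetRep_injOn.mono fun p hp => ?_
    simp only [cosetParams, Finset.coe_filter, Finset.mem_product, Finset.mem_range,
      Set.mem_ofPred_eq] at hp
    exact hp.1.2
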